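/- Let C = ⟨a, b⟩ be a non-linear HFP-code of type Q of length 4n = 2^s·n' with n' odd and s > 3. Then a^n ∉ K(C), and the dimension of the kernel K(C) is 1 or 2; moreover if k = 2 then the nontrivial kernel element (other than 0 and u) has the form a^ι · b for some ι. -/

import Mathlib

/-- The action of a coordinate permutation `σ` on a binary vector:
`(permAct σ v) i = v (σ⁻¹ i)`. -/
def permAct {m : ℕ} (σ : Equiv.Perm (Fin m)) (v : Fin m → ZMod 2) : Fin m → ZMod 2 :=
  fun i => v (σ.symm i)

/-- The propelinear operation `x · y = x + π_x(y)`. -/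
def pmul {m : ℕ} (π : (Fin m → ZMod 2) → Equiv.Perm (Fin m))
    (x y : Fin m → ZMod 2) : Fin m → ZMod 2 :=
  x + permAct (π x) y

/-- Powers with respect to the propelinear operation. -/
def ppow {m : ℕ} (π : (Fin m → ZMod 2) → Equiv.Perm (Fin m))
    (g : Fin m → ZMod 2) : ℕ → Fin m → ZMod 2
  | 0 => 0
  | k + 1 => pmul π g (ppow π g k)

/-- The all-ones vector. -/
def allOnes (m : ℕ) : Fin m → ZMod 2 := fun _ => 1

/-- The kernel `K(C) = {z : C + z = C}` of a binary code, as a set. -/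
def kset {m : ℕ} (C : Finset (Fin m → ZMod 2)) : Set (Fin m → ZMod 2) :=
  {z | (fun v => v + z) '' (C : Set (Fin m → ZMod 2)) = (C : Set (Fin m → ZMod 2))}


lemma aux_nil {V : Type*} [AddCommGroup V] [Module (ZMod 2) V] [Module.Finite (ZMod 2) V]
    (K : Submodule (ZMod 2) V) (N : Module.End (ZMod 2) V) (hN : ∀ v ∈ K, N v ∈ K)
    (m : ℕ) (hm : N ^ m = 0) (d : ℕ) (hd : Module.finrank (ZMod 2) K ≤ d)
    (v : V) (hv : v ∈ K) : (N ^ d) v = 0 := by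
  have key : ∀ j, ∀ w : K, (((N.restrict hN) ^ j) w : V) = (N ^ j) w := by
    intro j
    induction j with
    | zero => intro w; simp
    | succ j ih =>
      intro w
      rw [pow_succ, pow_succ, Module.End.mul_apply, Module.End.mul_apply, ih]
      rfl
  have hnil : IsNilpotent (N.restrict hN) := by
    refine ⟨m, ?_⟩
    ext w
    rw [key, hm]; simp
  have h1 := hnil.charpoly_eq_X_pow_finrank
  have h2 := LinearMap.aeval_self_charpoly (N.restrict hN)
  rw [h1] at h2
  simp only [map_pow, Polynomial.aeval_X] at h2
  have h3 : (N.restrict hN) ^ d = 0 := by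
    obtain ⟨c, rfl⟩ := Nat.exists_eq_add_of_le hd
    rw [pow_add, h2, zero_mul]
  have := key d ⟨v, hv⟩
  rw [h3] at this
  simpa using this.symm

section
variable {V : Type*} [AddCommGroup V] [Module (ZMod 2) V]
  {G : Type*} [Group G] (ι : G → V) (L : G →* Module.End (ZMod 2) V)

lemma end_two : (2 : Module.End (ZMod 2) V) = 0 := by
  ext v
  have : (2 : ZMod 2) • v = 0 := by
    have h : (2 : ZMod 2) = 0 := by decide
    rw [h, zero_smul]
  rw [two_smul] at this
  have h2 : (2 : Module.End (ZMod 2) V) = 1 + 1 := by norm_num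
  rw [h2]; simpa using this

lemma end_add_pow (A : Module.End (ZMod 2) V) (j : ℕ) :
    (A + 1) ^ (2 ^ j) = A ^ (2 ^ j) + 1 := by
  induction j with
  | zero => simp
  | succ j ih =>
    rw [pow_succ, pow_mul, ih, pow_mul, sq, sq, add_mul, mul_add, mul_add]
    simp only [mul_one, one_mul]
    have : A ^ 2 ^ j + A ^ 2 ^ j = 0 := by
      rw [← two_mul, end_two, zero_mul]
    rw [add_assoc, ← add_assoc (A ^ 2 ^ j) _ 1, this, zero_add]

lemma pow_formula (hmul : ∀ g h, ι (g * h) = ι g + L g (ι h)) (g : G) (j : ℕ) :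
    ι (g ^ (2 ^ j)) = ((L g + 1 : Module.End (ZMod 2) V) ^ (2 ^ j - 1)) (ι g) := by
  induction j with
  | zero => simp
  | succ j ih =>
    have e : 2 ^ (j + 1) - 1 = 2 ^ j + (2 ^ j - 1) := by
      have := Nat.one_le_two_pow (n := j)
      rw [pow_succ]; omega
    rw [e, pow_add (L g + 1), Module.End.mul_apply, ← ih, end_add_pow, pow_succ 2 j, mul_two, pow_add, hmul,
      map_pow]
    simp [add_comm]

theorem core [Finite G] [Module.Finite (ZMod 2) V]
    (hmul : ∀ g h, ι (g * h) = ι g + L g (ι h)) (hinj : Function.Injective ι)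
    (K : Submodule (ZMod 2) V) (hKr : ∀ v ∈ K, ∃ g, ι g = v)
    (hKL : ∀ g, ∀ v ∈ K, L g v ∈ K)
    (n s m : ℕ) (hn : 0 < n) (hcard : Nat.card G = 8 * n)
    (hsn : 4 * n = 2 ^ s * m) (hs : 3 < s)
    (α : G) (hα : orderOf α = 4 * n) (hu : ι (α ^ (2 * n)) ∈ K) :
    ι (α ^ n) ∉ K ∧ (Module.finrank (ZMod 2) K = 1 ∨ Module.finrank (ZMod 2) K = 2) ∧
    (∀ x, ι x ∈ K → x ∈ Subgroup.zpowers α → x = 1 ∨ x = α ^ (2 * n)) := by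
  have hι1 : ι 1 = 0 := by
    have := hmul 1 1
    simpa using this
  have hneg : ∀ v : V, v + v = 0 := by
    intro v
    have h : (2 : ZMod 2) = 0 := by decide
    rw [← two_smul (ZMod 2), h, zero_smul]
  let KG : Subgroup G :=
    { carrier := {x | ι x ∈ K}
      mul_mem' := by
        intro x y hx hy
        simp only [Set.mem_ofPred_eq] at *
        rw [hmul]; exact K.add_mem hx (hKL _ _ hy)
      one_mem' := by simp [hι1]
      inv_mem' := by
        intro x hx
        simp only [Set.mem_ofPred_eq] at *
        have h := hmul x⁻¹ x
        rw [inv_mul_cancel, hι1] at h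
        have h2 : ι x⁻¹ = - (L x⁻¹ (ι x)) := eq_neg_of_add_eq_zero_left h.symm
        rw [h2]
        exact K.neg_mem (hKL _ _ hx) }
  have hKGmem : ∀ x, x ∈ KG ↔ ι x ∈ K := fun x => Iff.rfl
  set k := Module.finrank (ZMod 2) K with hk
  have hKGcard : Nat.card KG = 2 ^ k := by
    have e : KG ≃ K := Equiv.ofBijective (fun x => ⟨ι x.1, x.2⟩) (by
      constructor
      · intro x y h
        apply Subtype.ext
        apply hinj
        simpa using h
      · rintro ⟨v, hv⟩
        obtain ⟨g, rfl⟩ := hKr v hv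
        exact ⟨⟨g, hv⟩, rfl⟩)
    rw [Nat.card_congr e, Module.natCard_eq_pow_finrank (K := ZMod 2)]
    simp [hk]
  set Z := Subgroup.zpowers α with hZ
  have hZcard : Nat.card Z = 4 * n := by rw [hZ, Nat.card_zpowers, hα]
  have hZind : Z.index = 2 := by
    have := Z.card_mul_index
    rw [hZcard, hcard] at this
    have h2 : 4 * n * Z.index = 4 * n * 2 := by rw [this]; ring
    exact Nat.eq_of_mul_eq_mul_left (by omega) h2
  have : Z.Normal := Subgroup.normal_of_index_eq_two hZind
  let H := Z.subgroupOf KG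
  have hHind : H.index ≤ 2 := by
    have : Z.relIndex KG ∣ Z.index := Subgroup.relIndex_dvd_index_of_normal Z KG
    rw [hZind] at this
    exact Nat.le_of_dvd (by norm_num) this
  have hHc : Nat.card H * H.index = 2 ^ k := by rw [H.card_mul_index, hKGcard]
  -- facts on powers
  have hunip : ∀ g : G, ∀ j d : ℕ, g ^ (2 ^ j) = 1 → k ≤ d → ∀ v ∈ K, ((L g + 1) ^ d) v = 0 := by
    intro g j d hg hd v hv
    refine aux_nil K (L g + 1) ?_ (2 ^ j) ?_ d hd v hv
    · intro v hv
      simpa using K.add_mem (hKL g v hv) hv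
    · rw [end_add_pow, ← map_pow, hg, map_one]
      have := end_two (V := V)
      rw [← this]; norm_num
  have hα4 : ∀ i : ℕ, α ^ i = 1 ↔ 4 * n ∣ i := by
    intro i; rw [← hα]; exact orderOf_dvd_iff_pow_eq_one.symm
  have hu1 : α ^ (2 * n) ≠ 1 := by
    rw [Ne, hα4]; intro h; have := Nat.le_of_dvd (by omega) h; omega
  have hu0 : ι (α ^ (2 * n)) ≠ 0 := by
    rw [← hι1]; exact fun h => hu1 (hinj h)
  -- k ≤ 4
  have hk4 : k ≤ 4 := by
    have : IsCyclic H := by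
      refine isCyclic_of_injective (G' := Z)
        ((KG.subtype.comp H.subtype).codRestrict Z (fun x => x.2)) ?_
      intro x y h
      apply Subtype.ext; apply Subtype.ext
      exact congrArg (fun t : Z => (t : G)) h
    obtain ⟨w, hw⟩ := IsCyclic.exists_generator (α := H)
    have hwo : orderOf w = Nat.card H := orderOf_eq_card_of_forall_mem_zpowers hw
    obtain ⟨r, hr, hrc⟩ := (Nat.dvd_prime_pow Nat.prime_two).1 (Dvd.intro _ hHc)
    have hkr : k ≤ r + 1 := by
      have : 2 ^ k ≤ 2 ^ (r + 1) := by
        rw [← hHc, hrc, pow_succ]; exact Nat.mul_le_mul_left _ hHind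
      exact (Nat.pow_le_pow_iff_right (by norm_num)).1 this
    by_contra hcon
    have hr4 : 4 ≤ r := by omega
    set g : G := w.1.1 with hg
    have hgo : orderOf g = 2 ^ r := by
      rw [hg, Subgroup.orderOf_coe, Subgroup.orderOf_coe, hwo, hrc]
    have hgK : ι g ∈ K := w.1.2
    have h1 : g ^ (2 ^ r) = 1 := by rw [← hgo]; exact pow_orderOf_eq_one g
    have hlt : ∀ r, 4 ≤ r → r + 1 ≤ 2 ^ (r - 1) - 1 := by
      intro r hr
      induction r, hr using Nat.le_induction with
      | base => norm_num
      | succ r hr ih =>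
        obtain ⟨t, rfl⟩ : ∃ t, r = t + 1 := ⟨r - 1, by omega⟩
        simp only [Nat.add_sub_cancel] at *
        rw [pow_succ]; omega
    have h2 := hunip g r (2 ^ (r - 1) - 1) h1 (hkr.trans (hlt r hr4)) _ hgK
    rw [← pow_formula ι L hmul, ← hι1] at h2
    have h3 := orderOf_dvd_of_pow_eq_one (hinj h2)
    rw [hgo] at h3
    have := (Nat.pow_dvd_pow_iff_le_right (by norm_num)).1 h3
    omega
  have hz : ι (α ^ n) ∉ K := by
    intro hzK
    obtain ⟨t, rfl⟩ : ∃ t, s = t + 2 := ⟨s - 2, by omega⟩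
    have hnt : n = m * 2 ^ t := by
      have : 4 * n = 4 * (m * 2 ^ t) := by rw [hsn, pow_add]; ring
      omega
    have h1 : (α ^ m) ^ (2 ^ (t + 2)) = 1 := by
      rw [← pow_mul, hα4, hsn, mul_comm]
    have h4 : 4 ≤ 2 ^ t := by
      calc 4 = 2 ^ 2 := by norm_num
        _ ≤ 2 ^ t := Nat.pow_le_pow_right (by norm_num) (by omega)
    have h2 := hunip _ _ (2 ^ t) h1 (hk4.trans h4) _ hzK
    rw [end_add_pow, ← map_pow, ← pow_mul, ← hnt] at h2
    apply hu0
    rw [two_mul, pow_add, hmul, add_comm]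
    simpa using h2
  have hthird : ∀ x, ι x ∈ K → x ∈ Z → x = 1 ∨ x = α ^ (2 * n) := by
    intro x hx hxZ
    obtain ⟨i, rfl⟩ : ∃ i : ℕ, α ^ i = x := by
      rw [hZ, ← mem_powers_iff_mem_zpowers] at hxZ
      exact hxZ
    have hord : (α ^ i) ^ (2 ^ k) = 1 := by
      have h : (⟨α ^ i, hx⟩ : KG) ^ (2 ^ k) = 1 := by
        rw [← hKGcard]; exact pow_card_eq_one'
      exact congrArg Subtype.val h
    -- all powers
    have hsq : ∀ j i : ℕ, ι (α ^ i) ∈ K → (α ^ i) ^ (2 ^ j) = 1 → (α ^ i) ^ 2 = 1 := by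
      intro j
      induction j with
      | zero => intro i _ h; simp only [pow_zero, pow_one] at h; rw [h, one_pow]
      | succ j ih =>
        intro i hi h
        have hi2 : ι (α ^ (i * 2)) ∈ K := by
          rw [pow_mul]; exact KG.pow_mem hi 2
        have h' := ih (i * 2) hi2 (by rw [pow_mul α i 2, ← pow_mul, ← pow_succ']; exact h)
        by_contra hne
        rw [← pow_mul, hα4] at h' hne
        obtain ⟨c, hc⟩ := h'
        have hic : i = n * c := by
          have : 4 * i = 4 * (n * c) := by rw [← mul_assoc, ← hc]; ring
          omega
        rcases Nat.even_or_odd c with ⟨d, hd⟩ | ⟨d, hd⟩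
        · apply hne; exact ⟨d, by rw [hic, hd]; ring⟩
        · apply hz
          have e : α ^ n = (α ^ i) * (α ^ (2 * n)) ^ d := by
            -- n c + 2 n d = n (4d+1)
            rw [← pow_mul, ← pow_add, hic, hd]
            have : n * (2 * d + 1) + 2 * n * d = n + (4 * n) * d := by ring
            rw [this, pow_add, pow_mul α (4 * n), (hα4 (4 * n)).2 dvd_rfl, one_pow, mul_one]
          rw [e]
          exact KG.mul_mem hi (KG.pow_mem hu d)
    have h2 := hsq k i hx hord
    rw [← pow_mul, hα4] at h2
    obtain ⟨c, hc⟩ := h2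
    have hic : i = 2 * n * c := by
      have : 2 * i = 2 * (2 * n * c) := by rw [mul_comm 2 i, hc]; ring
      omega
    rcases Nat.even_or_odd c with ⟨d, hd⟩ | ⟨d, hd⟩
    · left; rw [hα4]; exact ⟨d, by rw [hic, hd]; ring⟩
    · right
      have : i = 2 * n + 4 * n * d := by rw [hic, hd]; ring
      rw [this, pow_add, pow_mul α (4 * n), (hα4 (4 * n)).2 dvd_rfl, one_pow, mul_one]
  refine ⟨hz, ?_, hthird⟩
  have hH2 : Nat.card H ≤ 2 := by
    classical
    let f : H → Fin 2 := fun x => if ((x : KG) : G) = 1 then 0 else 1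
    have hf : Function.Injective f := by
      intro x y hxy
      apply Subtype.ext; apply Subtype.ext
      have hx := hthird x.1.1 x.1.2 x.2
      have hy := hthird y.1.1 y.1.2 y.2
      change (if x.1.1 = 1 then (0 : Fin 2) else 1) = (if y.1.1 = 1 then (0 : Fin 2) else 1) at hxy
      rcases hx with hx | hx <;> rcases hy with hy | hy <;> rw [hx, hy] at hxy ⊢
      · simp [hu1] at hxy
      · simp [hu1] at hxy
    simpa using Nat.card_le_card_of_injective f hf
  have hkle : k ≤ 2 := by
    have : 2 ^ k ≤ 2 ^ 2 := by
      rw [← hHc]; exact Nat.mul_le_mul hH2 hHind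
    exact (Nat.pow_le_pow_iff_right (by norm_num)).1 this
  have hk0 : k ≠ 0 := by
    intro h0
    rw [hk, Submodule.finrank_eq_zero] at h0
    rw [h0, Submodule.mem_bot] at hu
    exact hu0 hu
  omega
end

/-- Let `C = ⟨a, b⟩` be a non-linear HFP-code of type Q of length `4n = 2^s·n'` with
`n'` odd and `s > 3`. Then `aⁿ ∉ K(C)`, the dimension of `K(C)` is 1 or 2, and if it
is 2 then every nontrivial kernel element has the form `a^ι · b`. -/
theorem stmt_18 (n : ℕ) (hn : 0 < n) (C : Finset (Fin (4*n) → ZMod 2))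
    (π : (Fin (4*n) → ZMod 2) → Equiv.Perm (Fin (4*n)))
    (h0 : (0 : Fin (4*n) → ZMod 2) ∈ C) (hu : allOnes (4*n) ∈ C)
    (hcard : C.card = 8*n)
    (hclosed : ∀ x ∈ C, ∀ y ∈ C, pmul π x y ∈ C)
    (hhom : ∀ x ∈ C, ∀ y ∈ C, π (pmul π x y) = π x * π y)
    (hπ0 : π 0 = 1) (hπu : π (allOnes (4*n)) = 1)
    (hfree : ∀ x ∈ C, x ≠ 0 → x ≠ allOnes (4*n) → ∀ i, π x i ≠ i)
    (hdist : ∀ x ∈ C, ∀ y ∈ C, x ≠ y → x ≠ y + allOnes (4*n) → hammingDist x y = 2*n)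
    (a b : Fin (4*n) → ZMod 2) (ha : a ∈ C) (hb : b ∈ C)
    (haord : ∀ m : ℕ, 0 < m → m < 4*n → ppow π a m ≠ 0)
    (ha4n : ppow π a (4*n) = 0)
    (ha2n : ppow π a (2*n) = allOnes (4*n))
    (hb2 : pmul π b b = allOnes (4*n))
    (hrel : pmul π a b = pmul π b (ppow π a (4*n - 1)))
    (hgen : ∀ x ∈ C, ∃ i j : ℕ, x = pmul π (ppow π a i) (ppow π b j))
    (s nodd : ℕ) (hsn : 4*n = 2^s * nodd) (hodd : Odd nodd) (hs : 3 < s)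
    (hnonlinear : (C : Set (Fin (4*n) → ZMod 2)) ≠
      (Submodule.span (ZMod 2) (C : Set (Fin (4*n) → ZMod 2)) : Set (Fin (4*n) → ZMod 2))) :
    ppow π a n ∉ kset C ∧
    (Module.finrank (ZMod 2) (Submodule.span (ZMod 2) (kset C)) = 1 ∨
      Module.finrank (ZMod 2) (Submodule.span (ZMod 2) (kset C)) = 2) ∧
    (Module.finrank (ZMod 2) (Submodule.span (ZMod 2) (kset C)) = 2 →
      ∀ κ ∈ kset C, κ ≠ 0 → κ ≠ allOnes (4*n) →
        ∃ ι : ℕ, κ = pmul π (ppow π a ι) b) := by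
  classical
  have hz2 : ∀ x : ZMod 2, x + x = 0 := by decide
  have hv2 : ∀ v : Fin (4*n) → ZMod 2, v + v = 0 := fun v => funext fun i => hz2 _
  have hassoc : ∀ x ∈ C, ∀ y ∈ C, ∀ z, pmul π (pmul π x y) z = pmul π x (pmul π y z) := by
    intro x hx y hy z
    have h := hhom x hx y hy
    unfold pmul at h ⊢
    rw [h]
    funext i
    simp [permAct, add_assoc, Equiv.Perm.mul_def]
  have hone : ∀ x, pmul π 0 x = x := by
    intro x
    unfold pmul
    rw [hπ0]
    funext i
    simp only [permAct, Pi.add_apply, Pi.zero_apply, zero_add]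
    rfl
  have hpinj : ∀ x y z, pmul π x y = pmul π x z → y = z := by
    intro x y z h
    unfold pmul at h
    have h := add_left_cancel h
    funext i
    have := congrFun h (π x i)
    simpa [permAct] using this
  have hpzero : ∀ x, pmul π x 0 = x := by
    intro x
    funext i
    simp [pmul, permAct]
  have hrinv : ∀ x ∈ C, ∃ y ∈ C, pmul π x y = 0 := by
    intro x hx
    let f : C → C := fun y => ⟨pmul π x y.1, hclosed x hx y.1 y.2⟩
    have hf : Function.Injective f := fun y z h => Subtype.ext (hpinj x _ _ (congrArg Subtype.val h))
    obtain ⟨y, hy⟩ := (Finite.injective_iff_surjective.1 hf) ⟨0, h0⟩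
    exact ⟨y.1, y.2, congrArg Subtype.val hy⟩
  choose! inv hinvC hinv using hrinv
  letI : Mul C := ⟨fun x y => ⟨pmul π x.1 y.1, hclosed _ x.2 _ y.2⟩⟩
  letI : One C := ⟨⟨0, h0⟩⟩
  letI : Inv C := ⟨fun x => ⟨inv x.1, hinvC _ x.2⟩⟩
  letI : Group C := Group.ofRightAxioms
    (fun x y z => Subtype.ext (hassoc _ x.2 _ y.2 _))
    (fun x => Subtype.ext (hpzero _))
    (fun x => Subtype.ext (hinv _ x.2))
  have hmulval : ∀ x y : C, (x * y).1 = pmul π x.1 y.1 := fun _ _ => rfl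
  have honeval : (1 : C).1 = 0 := rfl
  have hpowval : ∀ (x : C) (i : ℕ), (x ^ i).1 = ppow π x.1 i := by
    intro x i
    induction i with
    | zero => rw [pow_zero]; rfl
    | succ i ih => rw [pow_succ', hmulval, ih]; rfl
  let L : C →* Module.End (ZMod 2) (Fin (4*n) → ZMod 2) :=
    { toFun := fun x => LinearMap.funLeft (ZMod 2) (ZMod 2) (π x.1).symm
      map_one' := by
        rw [honeval, hπ0]; rfl
      map_mul' := by
        intro x y
        rw [hmulval, hhom _ x.2 _ y.2]; rfl }
  have hLmul : ∀ g h : C, (g * h).1 = g.1 + L g h.1 := fun _ _ => rfl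
  have hkmem : ∀ z, z ∈ kset C ↔ ∀ v ∈ C, v + z ∈ C := by
    intro z
    constructor
    · intro h v hv
      have h1 : v + z ∈ (fun v => v + z) '' (C : Set (Fin (4*n) → ZMod 2)) := ⟨v, hv, rfl⟩
      have h2 : (fun v => v + z) '' (C : Set (Fin (4*n) → ZMod 2)) = C := h
      rw [h2] at h1
      exact h1
    · intro h
      change (fun v => v + z) '' (C : Set (Fin (4*n) → ZMod 2)) = C
      ext w
      constructor
      · rintro ⟨v, hv, rfl⟩; exact h v hv
      · intro hw
        exact ⟨w + z, h w hw, by simp [add_assoc, hv2]⟩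
  let K : Submodule (ZMod 2) (Fin (4*n) → ZMod 2) :=
    { carrier := kset C
      add_mem' := by
        intro x y hx hy
        rw [hkmem] at *
        intro v hv
        rw [← add_assoc]
        exact hy _ (hx _ hv)
      zero_mem' := by
        rw [hkmem]; intro v hv; simpa using hv
      smul_mem' := by
        intro c x hx
        rw [hkmem] at *
        intro v hv
        have hc : ∀ c : ZMod 2, c = 0 ∨ c = 1 := by decide
        rcases hc c with rfl | rfl
        · simpa using hv
        · simpa using hx v hv }
  have hspan : Submodule.span (ZMod 2) (kset C) = K := Submodule.span_eq K
  have hKC : ∀ v, v ∈ kset C → v ∈ C := by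
    intro v hv
    have := (hkmem v).1 hv 0 h0
    simpa using this
  have huK : allOnes (4*n) ∈ kset C := by
    rw [hkmem]
    intro v hv
    have h := hclosed _ hu _ hv
    unfold pmul at h
    rw [hπu, add_comm] at h
    exact h
  let α : C := ⟨a, ha⟩
  let β : C := ⟨b, hb⟩
  have hαpow : ∀ i, (α ^ i).1 = ppow π a i := fun i => hpowval α i
  have hord : orderOf α = 4 * n := by
    rw [orderOf_eq_iff (by omega)]
    refine ⟨Subtype.ext ((hαpow _).trans ha4n), ?_⟩
    intro m hm hm0 h
    exact haord m hm0 hm ((hαpow m).symm.trans (congrArg Subtype.val h))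
  have hα2 : (α ^ (2 * n)).1 = allOnes (4*n) := (hαpow _).trans ha2n
  obtain ⟨h1, h2, h3⟩ := core (fun x : C => x.1) L hLmul Subtype.val_injective K
    (fun v hv => ⟨⟨v, hKC v hv⟩, rfl⟩)
    (by
      intro g v hv
      change v ∈ kset C at hv
      change L g v ∈ kset C
      rw [hkmem] at *
      intro w hw
      have e : w + L g v = (g * ⟨_, hv _ (g⁻¹ * ⟨w, hw⟩).2⟩ : C).1 := by
        rw [hLmul]
        change _ = g.1 + L g ((g⁻¹ * ⟨w, hw⟩ : C).1 + v)
        rw [map_add, ← add_assoc, ← hLmul, mul_inv_cancel_left]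
      rw [e]
      exact Subtype.property _)
    n s nodd hn (by simp [hcard]) hsn hs α hord (by
      change (α ^ (2 * n)).1 ∈ kset C
      rw [hα2]; exact huK)
  rw [hspan]
  refine ⟨?_, h2, ?_⟩
  · rw [← hαpow]; exact h1
  · intro _ κ hκ hκ0 hκu
    obtain ⟨i, j, hij⟩ := hgen κ (hKC κ hκ)
    have hx : (⟨κ, hKC κ hκ⟩ : C) = α ^ i * β ^ j := by
      apply Subtype.ext
      rw [hmulval, hαpow, hpowval]
      exact hij
    have hββ : β ^ 2 = α ^ (2 * n) := by
      apply Subtype.ext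
      rw [hα2, sq, hmulval]
      exact hb2
    rcases Nat.even_or_odd j with ⟨d, hd⟩ | ⟨d, hd⟩
    · exfalso
      rw [hd, ← two_mul, pow_mul, hββ, ← pow_mul, ← pow_add] at hx
      rcases h3 ⟨κ, hKC κ hκ⟩ hκ (by rw [hx]; exact Subgroup.npow_mem_zpowers _ _) with h | h
      · exact hκ0 (congrArg Subtype.val h)
      · exact hκu ((congrArg Subtype.val h).trans hα2)
    · rw [hd, pow_succ, pow_mul, hββ, ← mul_assoc, ← pow_mul, ← pow_add] at hx
      refine ⟨i + 2 * n * d, ?_⟩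
      rw [← hαpow]
      exact congrArg Subtype.val hx
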